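/- Let k > 0, R > 0, and let u, S : ℝ² → ℂ be four times continuously differentiable on an open neighborhood of the closed disk {x : |x| ≤ R}, satisfying Δ²u − k⁴u = S and Δ²S − k⁴S = 0 on that neighborhood. Then ∫_{B_R} |S|² dx = ∫_{Γ_R} ( \bar{S} ∂_ν Δu − Δu ∂_ν \bar{S} ) ds + ∫_{Γ_R} ( Δ\bar{S} ∂_ν u − u ∂_ν Δ\bar{S} ) ds. -/

import Mathlib

open MeasureTheory Real Filter ComplexConjugate

noncomputable section

abbrev E2 := EuclideanSpace ℝ (Fin 2)

/-- The Laplacian on ℝ² as the sum of second directional derivatives. -/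
def lap (f : E2 → ℂ) (x : E2) : ℂ :=
  ∑ i : Fin 2, fderiv ℝ (fun y => fderiv ℝ f y (EuclideanSpace.single i (1:ℝ))) x
    (EuclideanSpace.single i (1:ℝ))

/-- Normal derivative on the circle of radius `R`: `∂_ν f (x) = ∇f(x)·(x/R)`. -/
def dnu (R : ℝ) (f : E2 → ℂ) (x : E2) : ℂ := fderiv ℝ f x (R⁻¹ • x)

/-- Point on the circle of radius `R` with polar angle `θ`. -/
def circPt (R θ : ℝ) : E2 := (WithLp.equiv 2 (Fin 2 → ℝ)).symm ![R * Real.cos θ, R * Real.sin θ]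

/-- Arclength integral over the circle `Γ_R`. -/
def circInt (R : ℝ) (g : E2 → ℂ) : ℂ := ∫ θ in (0:ℝ)..(2*Real.pi), g (circPt R θ) * (R:ℂ)

/-- Sommerfeld radiation condition with wavenumber `k`. -/
def Sommerfeld (k : ℝ) (w : E2 → ℂ) : Prop :=
  ∀ ε > 0, ∃ r₀ : ℝ, ∀ x : E2, r₀ ≤ ‖x‖ →
    ‖(Real.sqrt ‖x‖ : ℂ) * (fderiv ℝ w x (‖x‖⁻¹ • x) - Complex.I * (k:ℂ) * w x)‖ < ε

/-- `u` is a radiating solution of `Δ²u − k⁴u = S`. -/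
def RadiatingSolution (k : ℝ) (S u : E2 → ℂ) : Prop :=
  (∀ x : E2, lap (lap u) x - (k:ℂ)^4 * u x = S x) ∧ Sommerfeld k u ∧ Sommerfeld k (lap u)

/-- `S ∈ H(B_R)`: `L²(B_R)`-limit of smooth solutions of `Δ²v = k⁴v` on `B_R`. -/
def memH (k R : ℝ) (S : E2 → ℂ) : Prop :=
  ∃ v : ℕ → E2 → ℂ,
    (∀ j, ContDiffOn ℝ (⊤ : ℕ∞) (v j) (Metric.ball (0:E2) R)) ∧
    (∀ j, ∀ x ∈ Metric.ball (0:E2) R, lap (lap (v j)) x = (k:ℂ)^4 * v j x) ∧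
    Tendsto (fun j => ∫ x in Metric.ball (0:E2) R, ‖v j x - S x‖^2) atTop (nhds 0)

/-- The open square `V₀ = (−a/2, a/2)²`. -/
def V0 (a : ℝ) : Set E2 := {x | x 0 ∈ Set.Ioo (-(a/2)) (a/2) ∧ x 1 ∈ Set.Ioo (-(a/2)) (a/2)}

/-- Fourier basis function `φ_l(x) = exp(i (2π/a) l·x)`. -/
def phi (a : ℝ) (l : ℤ × ℤ) (x : E2) : ℂ :=
  Complex.exp (Complex.I * (2*Real.pi/a) * ((l.1 : ℂ) * ((x 0 : ℝ) : ℂ) + (l.2 : ℂ) * ((x 1 : ℝ) : ℂ)))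

/-- `φ_{l₀}(x) = exp(i (2π/a) λ x₁)` for `l₀ = (λ, 0)`. -/
def phi0 (a lam : ℝ) (x : E2) : ℂ :=
  Complex.exp (Complex.I * (2*Real.pi/a) * (lam : ℂ) * ((x 0 : ℝ) : ℂ))

lemma circPt_eq (r θ : ℝ) : circPt r θ =
    (r * Real.cos θ) • EuclideanSpace.single (0 : Fin 2) (1:ℝ)
      + (r * Real.sin θ) • EuclideanSpace.single (1 : Fin 2) (1:ℝ) := by
  ext i
  fin_cases i <;> simp [circPt]

lemma norm_circPt (r θ : ℝ) : ‖circPt r θ‖ = |r| := by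
  rw [EuclideanSpace.norm_eq, ← Real.sqrt_sq_eq_abs]
  congr 1
  simp [circPt, Fin.sum_univ_two]
  linear_combination r ^ 2 * Real.sin_sq_add_cos_sq θ

lemma continuous_circPt : Continuous fun p : ℝ × ℝ => circPt p.1 p.2 := by
  simp only [circPt_eq]
  fun_prop

lemma periodic_circPt (r : ℝ) : Function.Periodic (circPt r) (2 * Real.pi) := fun θ => by
  simp [circPt]

lemma exists_hasFDerivAt_circPt (p : ℝ × ℝ) :
    ∃ D : ℝ × ℝ →L[ℝ] E2, HasFDerivAt (fun p : ℝ × ℝ => circPt p.1 p.2) D p ∧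
      D (1, 0) = Real.cos p.2 • EuclideanSpace.single (0 : Fin 2) (1:ℝ)
        + Real.sin p.2 • EuclideanSpace.single (1 : Fin 2) (1:ℝ) ∧
      D (0, 1) = (-(p.1 * Real.sin p.2)) • EuclideanSpace.single (0 : Fin 2) (1:ℝ)
        + (p.1 * Real.cos p.2) • EuclideanSpace.single (1 : Fin 2) (1:ℝ) := by
  have hc : HasFDerivAt (fun q : ℝ × ℝ => Real.cos q.2)
      ((-Real.sin p.2) • ContinuousLinearMap.snd ℝ ℝ ℝ) p :=
    (Real.hasDerivAt_cos p.2).comp_hasFDerivAt p hasFDerivAt_snd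
  have hs : HasFDerivAt (fun q : ℝ × ℝ => Real.sin q.2)
      ((Real.cos p.2) • ContinuousLinearMap.snd ℝ ℝ ℝ) p :=
    (Real.hasDerivAt_sin p.2).comp_hasFDerivAt p hasFDerivAt_snd
  have h := ((hasFDerivAt_fst (𝕜 := ℝ) (p := p)).mul hc).smul_const
      (EuclideanSpace.single (0 : Fin 2) (1:ℝ))
    |>.add (((hasFDerivAt_fst (𝕜 := ℝ) (p := p)).mul hs).smul_const
      (EuclideanSpace.single (1 : Fin 2) (1:ℝ)))
  refine ⟨_, h.congr_of_eventuallyEq (.of_forall fun q => circPt_eq q.1 q.2), ?_, ?_⟩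
  · simp
  · simp

/-- Integration over a disk centred at the origin in polar coordinates. -/
lemma integral_ball_eq_integral_polar (R : ℝ) (G : E2 → ℂ) :
    ∫ x in Metric.ball (0:E2) R, G x =
      ∫ p in Set.Icc ((0:ℝ), -Real.pi) (R, Real.pi), p.1 • G (circPt p.1 p.2) := by
  let e : E2 ≃ᵐ ℝ × ℝ :=
    (MeasurableEquiv.toLp 2 (Fin 2 → ℝ)).symm.trans MeasurableEquiv.finTwoArrow
  have he : MeasurePreserving e volume volume :=
    (volume_preserving_finTwoArrow ℝ).comp
      (EuclideanSpace.volume_preserving_symm_measurableEquiv_toLp (Fin 2))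
  have hpol (p : ℝ × ℝ) : e.symm (polarCoord.symm p) = circPt p.1 p.2 := by
    rw [MeasurableEquiv.symm_apply_eq]
    simp [e, circPt, polarCoord]
  have hset : Set.Icc ((0:ℝ), -Real.pi) (R, Real.pi)
      =ᵐ[volume] (Set.Ioo 0 R ×ˢ Set.Ioo (-Real.pi) Real.pi : Set (ℝ × ℝ)) := by
    rw [Set.Icc_prod_eq, Measure.volume_eq_prod]
    exact (Measure.set_prod_ae_eq Ioo_ae_eq_Icc Ioo_ae_eq_Icc).symm
  rw [← integral_indicator measurableSet_ball, ← he.symm.integral_comp',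
    ← integral_comp_polarCoord_symm, setIntegral_congr_set hset,
    ← integral_indicator polarCoord.open_target.measurableSet,
    ← integral_indicator (measurableSet_Ioo.prod measurableSet_Ioo)]
  refine integral_congr_ae (.of_forall fun p => ?_)
  simp only [Set.indicator, polarCoord_target, Set.mem_prod, Set.mem_Ioi, Set.mem_Ioo, hpol,
    mem_ball_zero_iff, norm_circPt]
  by_cases h0 : 0 < p.1
  · by_cases h1 : p.1 < R <;> simp [h0, h1, abs_of_pos h0]
  · simp [h0]

/-- The divergence theorem on a disk centred at the origin. -/
lemma integral_ball_divergence {R : ℝ} (hR : 0 ≤ R) {U : Set E2} (hU : IsOpen U)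
    (hUR : Metric.closedBall (0:E2) R ⊆ U) {F : Fin 2 → E2 → ℂ}
    (hF : ∀ i, ContDiffOn ℝ 1 (F i) U) :
    ∫ x in Metric.ball (0:E2) R, ∑ i, fderiv ℝ (F i) x (EuclideanSpace.single i (1:ℝ)) =
      ∫ θ in (0:ℝ)..(2*Real.pi), (Real.cos θ • F 0 (circPt R θ)
        + Real.sin θ • F 1 (circPt R θ)) * (R:ℂ) := by
  set I : Set (ℝ × ℝ) := Set.Icc (0, -Real.pi) (R, Real.pi) with hI
  have hmaps : Set.MapsTo (fun p : ℝ × ℝ => circPt p.1 p.2) I U := fun p hp => by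
    apply hUR
    rw [mem_closedBall_zero_iff, norm_circPt, abs_of_nonneg hp.1.1]
    exact hp.2.1
  choose D hD hD1 hD2 using exists_hasFDerivAt_circPt
  have hFd (i) (p) (hp : p ∈ I) : HasFDerivAt (fun p : ℝ × ℝ => F i (circPt p.1 p.2))
      ((fderiv ℝ (F i) (circPt p.1 p.2)).comp (D p)) p :=
    ((((hF i).contDiffAt (hU.mem_nhds (hmaps hp))).differentiableAt one_ne_zero).hasFDerivAt).comp
      p (hD p)
  have hcos (p : ℝ × ℝ) : HasFDerivAt (fun q : ℝ × ℝ => Real.cos q.2)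
      ((-Real.sin p.2) • ContinuousLinearMap.snd ℝ ℝ ℝ) p :=
    (Real.hasDerivAt_cos p.2).comp_hasFDerivAt p hasFDerivAt_snd
  have hsin (p : ℝ × ℝ) : HasFDerivAt (fun q : ℝ × ℝ => Real.sin q.2)
      ((Real.cos p.2) • ContinuousLinearMap.snd ℝ ℝ ℝ) p :=
    (Real.hasDerivAt_sin p.2).comp_hasFDerivAt p hasFDerivAt_snd
  let c (p : ℝ × ℝ) : ℝ × ℝ →L[ℝ] ℝ := (-Real.sin p.2) • ContinuousLinearMap.snd ℝ ℝ ℝ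
  let s (p : ℝ × ℝ) : ℝ × ℝ →L[ℝ] ℝ := Real.cos p.2 • ContinuousLinearMap.snd ℝ ℝ ℝ
  let A (i : Fin 2) (p : ℝ × ℝ) : ℝ × ℝ →L[ℝ] ℂ := (fderiv ℝ (F i) (circPt p.1 p.2)).comp (D p)
  let f' (p : ℝ × ℝ) : ℝ × ℝ →L[ℝ] ℂ :=
    ((p.1 * Real.cos p.2) • A 0 p
      + (p.1 • c p + Real.cos p.2 • ContinuousLinearMap.fst ℝ ℝ ℝ).smulRight
          (F 0 (circPt p.1 p.2)))
    + ((p.1 * Real.sin p.2) • A 1 p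
      + (p.1 • s p + Real.sin p.2 • ContinuousLinearMap.fst ℝ ℝ ℝ).smulRight
          (F 1 (circPt p.1 p.2)))
  let g' (p : ℝ × ℝ) : ℝ × ℝ →L[ℝ] ℂ :=
    (Real.cos p.2 • A 1 p + (c p).smulRight (F 1 (circPt p.1 p.2)))
    - (Real.sin p.2 • A 0 p + (s p).smulRight (F 0 (circPt p.1 p.2)))
  have hf (p) (hp : p ∈ I) : HasFDerivAt (fun p : ℝ × ℝ =>
      (p.1 * Real.cos p.2) • F 0 (circPt p.1 p.2) + (p.1 * Real.sin p.2) • F 1 (circPt p.1 p.2))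
      (f' p) p :=
    ((hasFDerivAt_fst.mul (hcos p)).smul (hFd 0 p hp)).add
      ((hasFDerivAt_fst.mul (hsin p)).smul (hFd 1 p hp))
  have hg (p) (hp : p ∈ I) : HasFDerivAt (fun p : ℝ × ℝ =>
      Real.cos p.2 • F 1 (circPt p.1 p.2) - Real.sin p.2 • F 0 (circPt p.1 p.2)) (g' p) p :=
    ((hcos p).smul (hFd 1 p hp)).sub ((hsin p).smul (hFd 0 p hp))
  have hsub : Set.Ioo 0 R ×ˢ Set.Ioo (-Real.pi) Real.pi ⊆ I := by
    rw [hI, Set.Icc_prod_eq]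
    exact Set.prod_mono Set.Ioo_subset_Icc_self Set.Ioo_subset_Icc_self
  have hdiv (p : ℝ × ℝ) : f' p (1, 0) + g' p (0, 1) = p.1 • ∑ i,
      fderiv ℝ (F i) (circPt p.1 p.2) (EuclideanSpace.single i (1:ℝ)) := by
    simp only [f', g', A, c, s, Fin.sum_univ_two, add_apply,
      sub_apply, smul_apply,
      ContinuousLinearMap.smulRight_apply, ContinuousLinearMap.comp_apply, hD1, hD2, map_add,
      map_smul, ContinuousLinearMap.coe_fst', ContinuousLinearMap.coe_snd', Complex.real_smul,
      smul_eq_mul]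
    push_cast
    generalize fderiv ℝ (F 0) (circPt p.1 p.2) = L
    generalize fderiv ℝ (F 1) (circPt p.1 p.2) = M
    linear_combination p.1 * (L (EuclideanSpace.single 0 (1:ℝ))
      + M (EuclideanSpace.single 1 (1:ℝ))) * Complex.sin_sq_add_cos_sq p.2
  have hdF (i) : ContinuousOn (fun p : ℝ × ℝ =>
      fderiv ℝ (F i) (circPt p.1 p.2) (EuclideanSpace.single i (1:ℝ))) I :=
    (((hF i).continuousOn_fderiv_of_isOpen hU le_rfl).comp
      continuous_circPt.continuousOn hmaps).clm_apply continuousOn_const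
  have key := integral_divergence_prod_Icc_of_hasFDerivAt_of_le _ _ f' g' (0, -Real.pi) (R, Real.pi)
    ⟨hR, by dsimp; linarith [Real.pi_pos]⟩ (fun p hp => (hf p hp).continuousAt.continuousWithinAt)
    (fun p hp => (hg p hp).continuousAt.continuousWithinAt)
    (fun p hp => hf p (hsub hp)) (fun p hp => hg p (hsub hp)) (by
      simp only [hdiv]
      refine ContinuousOn.integrableOn_compact isCompact_Icc ?_
      exact continuous_fst.continuousOn.smul (continuousOn_finsetSum _ fun i _ => hdF i))
  have hpi (r : ℝ) : circPt r (-Real.pi) = circPt r Real.pi := by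
    simp [circPt]
  have hper : Function.Periodic (fun θ => (Real.cos θ • F 0 (circPt R θ)
        + Real.sin θ • F 1 (circPt R θ)) * (R:ℂ)) (2 * Real.pi) := fun θ => by
    simp only [periodic_circPt R θ, Real.cos_periodic θ, Real.sin_periodic θ]
  have hshift := hper.intervalIntegral_add_eq 0 (-Real.pi)
  rw [zero_add, show -Real.pi + 2 * Real.pi = Real.pi by ring] at hshift
  rw [integral_ball_eq_integral_polar, hshift]
  simp only [hdiv] at key
  rw [key]
  simp only [hpi, Real.cos_neg, Real.sin_neg, Real.sin_pi, neg_zero, zero_smul, zero_mul, add_zero,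
    sub_self, zero_add, intervalIntegral.integral_zero, sub_zero]
  refine intervalIntegral.integral_congr fun θ _ => ?_
  simp only [Complex.real_smul]
  push_cast
  ring

lemma ContDiffOn.lap {f : E2 → ℂ} {U : Set E2} (hU : IsOpen U) {m n : WithTop ℕ∞}
    (hf : ContDiffOn ℝ n f U) (hmn : m + 2 ≤ n) : ContDiffOn ℝ m (lap f) U := by
  have h (i : Fin 2) : ContDiffOn ℝ (m + 1)
      (fun y => fderiv ℝ f y (EuclideanSpace.single i (1:ℝ))) U :=
    (hf.fderiv_of_isOpen hU (by rwa [add_assoc, one_add_one_eq_two])).clm_apply contDiffOn_const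
  exact ContDiffOn.sum fun i _ => ((h i).fderiv_of_isOpen hU le_rfl).clm_apply contDiffOn_const

lemma dnu_circPt {R : ℝ} (hR : R ≠ 0) (f : E2 → ℂ) (θ : ℝ) :
    dnu R f (circPt R θ) =
      Real.cos θ • fderiv ℝ f (circPt R θ) (EuclideanSpace.single 0 (1:ℝ))
        + Real.sin θ • fderiv ℝ f (circPt R θ) (EuclideanSpace.single 1 (1:ℝ)) := by
  have h : R⁻¹ • circPt R θ = Real.cos θ • EuclideanSpace.single (0 : Fin 2) (1:ℝ)
      + Real.sin θ • EuclideanSpace.single (1 : Fin 2) (1:ℝ) := by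
    rw [circPt_eq, smul_add, smul_smul, smul_smul, inv_mul_cancel_left₀ hR,
      inv_mul_cancel_left₀ hR]
  rw [dnu, h, map_add, map_smul, map_smul]

lemma fderiv_conj_apply (f : E2 → ℂ) (x v : E2) :
    fderiv ℝ (fun y => conj (f y)) x v = conj (fderiv ℝ f x v) := by
  have := Complex.conjCLE.comp_fderiv (f := f) (x := x)
  exact congrArg (fun L => L v) this

/-- Green's second identity, in sesquilinear form, on a disk centred at the origin. -/
lemma integral_ball_green {R : ℝ} (hR : 0 < R) {U : Set E2} (hU : IsOpen U)
    (hUR : Metric.closedBall (0:E2) R ⊆ U) {v w : E2 → ℂ}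
    (hv : ContDiffOn ℝ 2 v U) (hw : ContDiffOn ℝ 2 w U) :
    ∫ x in Metric.ball (0:E2) R, (conj (w x) * lap v x - v x * conj (lap w x)) =
      circInt R (fun x => conj (w x) * dnu R v x - v x * conj (dnu R w x)) := by
  have hd {f : E2 → ℂ} (hf : ContDiffOn ℝ 2 f U) (i : Fin 2) :
      ContDiffOn ℝ 1 (fun y => fderiv ℝ f y (EuclideanSpace.single i (1:ℝ))) U :=
    (hf.fderiv_of_isOpen hU (by norm_num)).clm_apply contDiffOn_const
  have hconj {n : WithTop ℕ∞} {f : E2 → ℂ} (hf : ContDiffOn ℝ n f U) :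
      ContDiffOn ℝ n (fun y => conj (f y)) U :=
    Complex.conjCLE.contDiff.comp_contDiffOn hf
  have hv1 := hv.of_le one_le_two
  have hw1 := hw.of_le one_le_two
  have key := integral_ball_divergence hR.le hU hUR
    (F := fun i x => conj (w x) * fderiv ℝ v x (EuclideanSpace.single i (1:ℝ))
      - v x * conj (fderiv ℝ w x (EuclideanSpace.single i (1:ℝ))))
    (fun i => ((hconj hw1).mul (hd hv i)).sub (hv1.mul (hconj (hd hw i))))
  have hdiff {f : E2 → ℂ} (hf : ContDiffOn ℝ 1 f U) {x : E2} (hx : x ∈ U) :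
      DifferentiableAt ℝ f x :=
    (hf.contDiffAt (hU.mem_nhds hx)).differentiableAt one_ne_zero
  rw [circInt]
  refine Eq.trans (setIntegral_congr_fun measurableSet_ball fun x hx => ?_) (key.trans ?_)
  · have hxU : x ∈ U := hUR (Metric.ball_subset_closedBall hx)
    have hterm (i : Fin 2) := fderiv_fun_sub (𝕜 := ℝ)
      ((hdiff (hconj hw1) hxU).fun_mul (hdiff (hd hv i) hxU))
      ((hdiff hv1 hxU).fun_mul (hdiff (hconj (hd hw i)) hxU))
    have hmul1 (i : Fin 2) := fderiv_fun_mul (𝕜 := ℝ)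
      (hdiff (hconj hw1) hxU) (hdiff (hd hv i) hxU)
    have hmul2 (i : Fin 2) := fderiv_fun_mul (𝕜 := ℝ)
      (hdiff hv1 hxU) (hdiff (hconj (hd hw i)) hxU)
    simp only [lap, Fin.sum_univ_two, hterm, hmul1, hmul2, sub_apply,
      add_apply, smul_apply, smul_eq_mul,
      fderiv_conj_apply, map_add]
    ring
  · refine intervalIntegral.integral_congr fun θ _ => ?_
    simp only [dnu_circPt hR.ne', Complex.real_smul, map_add, map_mul, Complex.conj_ofReal]
    ring

/-- Energy identity: if `Δ²u − k⁴u = S` and `Δ²S = k⁴S`, then `∫_{B_R}|S|²` equals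
the boundary terms on `Γ_R`. -/
theorem source_energy_boundary_identity (k R : ℝ) (hk : 0 < k) (hR : 0 < R)
    (U : Set E2) (hU : IsOpen U) (hUR : Metric.closedBall (0:E2) R ⊆ U)
    (u S : E2 → ℂ) (hu : ContDiffOn ℝ 4 u U) (hS : ContDiffOn ℝ 4 S U)
    (hueq : ∀ x ∈ U, lap (lap u) x - (k:ℂ)^4 * u x = S x)
    (hSeq : ∀ x ∈ U, lap (lap S) x - (k:ℂ)^4 * S x = 0) :
    ((∫ x in Metric.ball (0:E2) R, ‖S x‖^2 : ℝ) : ℂ) =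
      circInt R (fun x => conj (S x) * dnu R (lap u) x - lap u x * conj (dnu R S x))
      + circInt R (fun x => conj (lap S x) * dnu R u x - u x * conj (dnu R (lap S) x)) := by
  have hu2 : ContDiffOn ℝ 2 u U := hu.of_le (by norm_num)
  have hS2 : ContDiffOn ℝ 2 S U := hS.of_le (by norm_num)
  have hlu : ContDiffOn ℝ 2 (lap u) U := hu.lap hU (by norm_num)
  have hlS : ContDiffOn ℝ 2 (lap S) U := hS.lap hU (by norm_num)
  have hllu : ContinuousOn (lap (lap u)) U :=
    (hlu.lap (m := 0) hU (by norm_num)).continuousOn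
  have hllS : ContinuousOn (lap (lap S)) U :=
    (hlS.lap (m := 0) hU (by norm_num)).continuousOn
  have hint {a b c d : E2 → ℂ} (ha : ContinuousOn a U) (hb : ContinuousOn b U)
      (hc : ContinuousOn c U) (hd : ContinuousOn d U) :
      IntegrableOn (fun x => conj (a x) * b x - c x * conj (d x)) (Metric.ball 0 R) := by
    have hconj {f : E2 → ℂ} (hf : ContinuousOn f U) : ContinuousOn (fun y => conj (f y)) U :=
      Complex.continuous_conj.comp_continuousOn hf
    exact (((((hconj ha).mul hb).sub (hc.mul (hconj hd))).mono hUR).integrableOn_compact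
      (isCompact_closedBall 0 R)).mono_set Metric.ball_subset_closedBall
  rw [← integral_ball_green hR hU hUR hlu hS2, ← integral_ball_green hR hU hUR hu2 hlS,
    ← integral_add (hint hS.continuousOn hllu hlu.continuousOn hlS.continuousOn)
      (hint hlS.continuousOn hlu.continuousOn hu.continuousOn hllS),
    ← integral_complex_ofReal]
  refine setIntegral_congr_fun measurableSet_ball fun x hx => ?_
  have hxU : x ∈ U := hUR (Metric.ball_subset_closedBall hx)
  have hSx : conj (lap (lap S) x) = (k:ℂ) ^ 4 * conj (S x) := by
    rw [sub_eq_zero.mp (hSeq x hxU)]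
    simp
  have hux := hueq x hxU
  have hnorm : conj (S x) * S x = ((‖S x‖ ^ 2 : ℝ) : ℂ) := by
    rw [Complex.conj_mul']
    push_cast
    rfl
  simp only [hSx, ← hnorm]
  linear_combination -conj (S x) * hux
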